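/- Under the standing assumptions, let q be a prime divisor of m, let α_q = ν_q(m) be the q-adic valuation of m, and let d(m) be the number of positive divisors of m. Then α_q·d(m) is even, q^(α_q·d(m)/2 − 1) divides x₁^(q−1) − y₁^(q−1), and if moreover q does not divide z, then q^(α_q·d(m)/2) divides x₁^(q−1) − y₁^(q−1). -/

import Mathlib

/-- Homogenised cyclotomic value. -/
noncomputable def homCyc (a b d : ℕ) : ℤ :=
  (Polynomial.scaleRoots (Polynomial.cyclotomic d ℤ) (b : ℤ)).eval (a : ℤ)

/-- Order of `a / b` modulo `p`. -/
noncomputable def ordq (a b p : ℕ) : ℕ := orderOf ((a : ZMod p) * (b : ZMod p)⁻¹)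

lemma ordq_dvd_iff {a b p : ℕ} (hp : p.Prime) (hb : ¬ p ∣ b) (k : ℕ) :
    ordq a b p ∣ k ↔ (p : ℤ) ∣ (a : ℤ) ^ k - (b : ℤ) ^ k := by
  have := Fact.mk hp
  have hb' : (b : ZMod p) ≠ 0 := by
    rwa [Ne, ZMod.natCast_eq_zero_iff]
  have hbk : (b : ZMod p) ^ k ≠ 0 := pow_ne_zero _ hb'
  rw [ordq, orderOf_dvd_iff_pow_eq_one, ← ZMod.intCast_zmod_eq_zero_iff_dvd]
  push_cast
  rw [mul_pow, inv_pow, sub_eq_zero, mul_inv_eq_one₀ hbk]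

lemma ordq_dvd_sub_one {a b p : ℕ} (hp : p.Prime) (hb : ¬ p ∣ b) (ha : ¬ p ∣ a) :
    ordq a b p ∣ p - 1 := by
  have := Fact.mk hp
  apply ZMod.orderOf_dvd_card_sub_one
  apply mul_ne_zero
  · rwa [Ne, ZMod.natCast_eq_zero_iff]
  · apply inv_ne_zero
    rwa [Ne, ZMod.natCast_eq_zero_iff]

lemma scaleRoots_X_pow_sub_one_eval (a b d : ℕ) (hd : 0 < d) :
    (Polynomial.scaleRoots (Polynomial.X ^ d - 1 : Polynomial ℤ) (b : ℤ)).eval (a : ℤ)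
      = (a : ℤ) ^ d - (b : ℤ) ^ d := by
  have h : Polynomial.scaleRoots (Polynomial.X ^ d - 1 : Polynomial ℤ) (b : ℤ)
      = Polynomial.X ^ d - Polynomial.C ((b : ℤ) ^ d) := by
    ext i
    have hn : (Polynomial.X ^ d - 1 : Polynomial ℤ).natDegree = d := by
      simpa using Polynomial.natDegree_X_pow_sub_C (n := d) (r := (1 : ℤ))
    rw [Polynomial.coeff_scaleRoots, hn]
    simp only [Polynomial.coeff_sub, Polynomial.coeff_X_pow, Polynomial.coeff_one,
      Polynomial.coeff_C]
    by_cases h1 : i = d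
    · subst h1
      simp [hd.ne']
    · by_cases h2 : i = 0
      · subst h2
        simp [h1]
      · simp [h1, h2]
  rw [h]; simp

lemma homCyc_dvd_geom {a b d l : ℕ} (hab : b < a) (hd : 0 < d) (hl : 1 < l) (hld : l ∣ d) :
    homCyc a b d ∣ ∑ i ∈ Finset.range l,
      ((a : ℤ) ^ (d / l)) ^ i * ((b : ℤ) ^ (d / l)) ^ (l - 1 - i) := by
  have hpos : 0 < d / l := Nat.div_pos (Nat.le_of_dvd hd hld) (by omega)
  have hmem : d / l ∈ d.properDivisors := by
    rw [Nat.mem_properDivisors]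
    exact ⟨Nat.div_dvd_of_dvd hld, Nat.div_lt_self hd hl⟩
  have h := Polynomial.X_pow_sub_one_mul_cyclotomic_dvd_X_pow_sub_one_of_dvd ℤ hmem
  have h2 := Polynomial.scaleRoots_dvd _ _ (r := (b : ℤ)) h
  rw [Polynomial.mul_scaleRoots_of_noZeroDivisors] at h2
  have h3 := Polynomial.eval_dvd (x := (a : ℤ)) h2
  rw [Polynomial.eval_mul, scaleRoots_X_pow_sub_one_eval _ _ _ hd,
    scaleRoots_X_pow_sub_one_eval _ _ _ hpos] at h3
  have h4 := geom_sum₂_mul ((a : ℤ) ^ (d / l)) ((b : ℤ) ^ (d / l)) l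
  rw [← pow_mul, ← pow_mul, Nat.div_mul_cancel hld] at h4
  rw [← h4, mul_comm] at h3
  have hne : (a : ℤ) ^ (d / l) - (b : ℤ) ^ (d / l) ≠ 0 := by
    have : (b : ℤ) ^ (d / l) < (a : ℤ) ^ (d / l) := by
      exact_mod_cast Nat.pow_lt_pow_left hab hpos.ne'
    linarith
  exact (mul_dvd_mul_iff_right hne).mp h3

lemma homCyc_dvd {a b d : ℕ} (hd : 0 < d) :
    homCyc a b d ∣ (a : ℤ) ^ d - (b : ℤ) ^ d := by
  have h2 := Polynomial.scaleRoots_dvd _ _ (r := (b : ℤ))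
    (Polynomial.cyclotomic.dvd_X_pow_sub_one d ℤ)
  have h3 := Polynomial.eval_dvd (x := (a : ℤ)) h2
  rwa [scaleRoots_X_pow_sub_one_eval _ _ _ hd] at h3

lemma homCyc_real {a b d : ℕ} (hb : 0 < b) :
    (homCyc a b d : ℝ) = (b : ℝ) ^ d.totient *
      (Polynomial.cyclotomic d ℝ).eval ((a : ℝ) / b) := by
  have h := Polynomial.scaleRoots_eval₂_mul (p := Polynomial.cyclotomic d ℤ)
    (Int.castRingHom ℝ) ((a : ℝ) / b) (b : ℤ)
  rw [Polynomial.natDegree_cyclotomic] at h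
  have hb' : (b : ℝ) ≠ 0 := by positivity
  have e1 : (Int.castRingHom ℝ) (b : ℤ) * ((a : ℝ) / b) = (Int.castRingHom ℝ) (a : ℤ) := by
    simp; field_simp
  rw [e1, Polynomial.eval₂_at_apply, Polynomial.eval₂_eq_eval_map,
    Polynomial.map_cyclotomic] at h
  simpa [homCyc] using h

lemma homCyc_gt_one {a b d : ℕ} (hb : 0 < b) (hab : b < a) (hd : 2 ≤ d) : 1 < homCyc a b d := by
  have hb' : (0 : ℝ) < b := by exact_mod_cast hb
  have ht : (1 : ℝ) < (a : ℝ) / b := by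
    rw [one_lt_div hb']; exact_mod_cast hab
  have h := Polynomial.sub_one_pow_totient_lt_cyclotomic_eval hd ht
  have h2 : (1 : ℝ) < homCyc a b d := by
    rw [homCyc_real hb]
    calc (1 : ℝ) ≤ ((a : ℝ) - b) ^ d.totient := by
          apply one_le_pow₀
          have : (b : ℝ) + 1 ≤ a := by exact_mod_cast hab
          linarith
      _ = (b : ℝ) ^ d.totient * ((a : ℝ) / b - 1) ^ d.totient := by
          rw [← mul_pow]; congr 1; field_simp
      _ < _ := by
          apply mul_lt_mul_of_pos_left h; positivity
  exact_mod_cast h2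

lemma cyc_eval_rel {o p : ℕ} (hp : p.Prime) (hpo : ¬ p ∣ o) (k : ℕ) : ∀ t : ℝ,
    (Polynomial.cyclotomic (o * p ^ (k + 1)) ℝ).eval t *
      (Polynomial.cyclotomic o ℝ).eval (t ^ p ^ k)
      = (Polynomial.cyclotomic o ℝ).eval ((t ^ p ^ k) ^ p) := by
  induction k with
  | zero =>
    intro t
    have := congrArg (Polynomial.eval t) (Polynomial.cyclotomic_expand_eq_cyclotomic_mul hp hpo ℝ)
    rw [Polynomial.expand_eval, Polynomial.eval_mul] at this
    simp [this]
  | succ k ih =>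
    intro t
    have := congrArg (Polynomial.eval t) (Polynomial.cyclotomic_expand_eq_cyclotomic hp
      (n := o * p ^ (k + 1)) (Dvd.dvd.mul_left (dvd_pow_self _ (by omega)) _) ℝ)
    rw [Polynomial.expand_eval] at this
    have h2 := ih (t ^ p)
    rw [this, ← pow_mul, ← pow_succ', mul_assoc, ← pow_succ] at h2
    exact h2

lemma homCyc_bound {a b o p k : ℕ} (hb : 0 < b) (hab : b < a) (hp : p.Prime) (hpo : ¬ p ∣ o) :
    ((a : ℤ) ^ (p ^ k * p) - (b : ℤ) ^ (p ^ k * p)) ^ o.totient ≤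
      homCyc a b (o * p ^ (k + 1)) * ((a : ℤ) ^ p ^ k + (b : ℤ) ^ p ^ k) ^ o.totient := by
  have hb' : (0 : ℝ) < b := by exact_mod_cast hb
  have ht : (1 : ℝ) < (a : ℝ) / b := by
    rw [one_lt_div hb']; exact_mod_cast hab
  have hrel := cyc_eval_rel hp hpo k ((a : ℝ) / b)
  have hreal := homCyc_real (a := a) (d := o * p ^ (k + 1)) hb
  have hcop : Nat.Coprime o (p ^ (k + 1)) :=
    Nat.Coprime.pow_right _ ((Nat.Prime.coprime_iff_not_dvd hp).mpr hpo).symm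
  rw [Nat.totient_mul hcop, Nat.totient_prime_pow_succ hp] at hreal
  have hpk : p ^ k ≠ 0 := pow_ne_zero _ hp.ne_zero
  have hs : 1 < ((a : ℝ) / b) ^ p ^ k := one_lt_pow₀ ht hpk
  have hsp : 1 < (((a : ℝ) / b) ^ p ^ k) ^ p := one_lt_pow₀ hs hp.ne_zero
  have u := Polynomial.cyclotomic_eval_le_add_one_pow_totient hs o
  have l := Polynomial.sub_one_pow_totient_le_cyclotomic_eval hsp o
  have hdpos : 0 ≤ (Polynomial.cyclotomic (o * p ^ (k + 1)) ℝ).eval ((a : ℝ) / b) :=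
    Polynomial.cyclotomic_nonneg _ ht.le
  set P := (Polynomial.cyclotomic (o * p ^ (k + 1)) ℝ).eval ((a : ℝ) / b)
  set s := ((a : ℝ) / b) ^ p ^ k with hsdef
  set B := (b : ℝ) ^ p ^ k with hB
  have hBpos : 0 < B := by positivity
  have hA : (a : ℝ) ^ p ^ k = B * s := by
    rw [hB, hsdef, ← mul_pow]; congr 1; field_simp
  have hp1 : p - 1 + 1 = p := Nat.sub_add_cancel hp.one_le
  have key : (((a : ℝ) ^ (p ^ k * p) - (b : ℝ) ^ (p ^ k * p))) ^ o.totient ≤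
      (homCyc a b (o * p ^ (k + 1)) : ℝ) * ((a : ℝ) ^ p ^ k + (b : ℝ) ^ p ^ k) ^ o.totient := by
    rw [hreal, pow_mul, pow_mul, ← hB, hA]
    have e1 : (b : ℝ) ^ (o.totient * (p ^ k * (p - 1))) = (B ^ (p - 1)) ^ o.totient := by
      rw [hB, ← pow_mul, ← pow_mul]; congr 1; ring
    have e2 : (B ^ p) ^ o.totient = (B ^ (p - 1)) ^ o.totient * B ^ o.totient := by
      rw [← mul_pow, ← pow_succ, hp1]
    calc ((B * s) ^ p - B ^ p) ^ o.totient = (B ^ p) ^ o.totient * (s ^ p - 1) ^ o.totient := by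
          rw [mul_pow B s p, ← mul_pow (B ^ p), mul_sub, mul_one]
      _ ≤ (B ^ p) ^ o.totient * (P * (s + 1) ^ o.totient) := by
          apply mul_le_mul_of_nonneg_left _ (by positivity)
          refine l.trans ?_
          rw [← hrel]
          exact mul_le_mul_of_nonneg_left u hdpos
      _ = _ := by
          rw [e1, e2, show B * s + B = B * (s + 1) by ring, mul_pow]; ring
  exact_mod_cast key

lemma homCyc_two_pow {a b k : ℕ} (hb : 0 < b) (hab : b < a) : 2 < homCyc a b (2 ^ (k + 1)) := by
  have hb' : (0 : ℝ) < b := by exact_mod_cast hb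
  have ht : (1 : ℝ) < (a : ℝ) / b := by
    rw [one_lt_div hb']; exact_mod_cast hab
  have h : (2 : ℝ) < homCyc a b (2 ^ (k + 1)) := by
    rw [homCyc_real hb, Polynomial.cyclotomic_prime_pow_eq_geom_sum Nat.prime_two]
    simp only [Finset.sum_range_succ, Finset.sum_range_zero, Polynomial.eval_add,
      Polynomial.eval_pow, Polynomial.eval_X, Polynomial.eval_zero]
    have h1 : 1 < ((a : ℝ) / b) ^ 2 ^ k := one_lt_pow₀ ht (by positivity)
    have h2 : (1 : ℝ) ≤ (b : ℝ) ^ (2 ^ (k + 1)).totient := by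
      apply one_le_pow₀; exact_mod_cast hb
    simp only [pow_zero, pow_one, zero_add]
    nlinarith
  exact_mod_cast h

lemma coprime_not_dvd {a b d p : ℕ} (hc : a.Coprime b) (hd : 0 < d) (hp : p.Prime)
    (h : (p : ℤ) ∣ (a : ℤ) ^ d - (b : ℤ) ^ d) : ¬ p ∣ a ∧ ¬ p ∣ b := by
  have hpi : Prime (p : ℤ) := Nat.prime_iff_prime_int.mp hp
  have hiff : p ∣ a ↔ p ∣ b := by
    rw [← Int.natCast_dvd_natCast, ← Int.natCast_dvd_natCast (n := b)]
    constructor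
    · intro h1
      have h2 := dvd_pow h1 hd.ne'
      exact hpi.dvd_of_dvd_pow ((dvd_sub_right h2).mp h)
    · intro h1
      have h2 := dvd_pow h1 hd.ne'
      exact hpi.dvd_of_dvd_pow ((dvd_sub_left h2).mp h)
  have hnot : ¬ (p ∣ a ∧ p ∣ b) := fun ⟨h1, h2⟩ => hp.one_lt.ne'
    (Nat.dvd_one.mp (by have := Nat.dvd_gcd h1 h2; rwa [hc] at this))
  tauto

lemma nonprim_struct {a b d p : ℕ} (hab : b < a) (hc : a.Coprime b) (hd : 0 < d)
    (hp : p.Prime) (h : (p : ℤ) ∣ homCyc a b d) (hne : ordq a b p ≠ d) :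
    ∃ k, d = ordq a b p * p ^ (k + 1) ∧ ordq a b p ∣ p - 1 := by
  have hpi : Prime (p : ℤ) := Nat.prime_iff_prime_int.mp hp
  have h0 := h.trans (homCyc_dvd hd)
  obtain ⟨hpa, hpb⟩ := coprime_not_dvd hc hd hp h0
  have hod : ordq a b p ∣ d := (ordq_dvd_iff hp hpb d).mpr h0
  have ho1 := ordq_dvd_sub_one hp hpb hpa
  obtain ⟨r, hr⟩ := hod
  have hr0 : r ≠ 0 := by rintro rfl; simp at hr; omega
  have huniq : ∀ {l : ℕ}, l.Prime → l ∣ r → l = p := by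
    intro l hl hlr
    by_contra hlp
    have hld : l ∣ d := hr ▸ hlr.mul_left _
    have hsub : (p : ℤ) ∣ (a : ℤ) ^ (d / l) - (b : ℤ) ^ (d / l) := by
      rw [← ordq_dvd_iff hp hpb]
      obtain ⟨s, rfl⟩ := hlr
      rw [hr, mul_left_comm, Nat.mul_div_cancel_left _ hl.pos]
      exact dvd_mul_right _ _
    refine not_dvd_geom_sum₂ hpi hsub ?_ ?_ (h.trans (homCyc_dvd_geom hab hd hl.one_lt hld))
    · intro h3
      exact hpa (Int.natCast_dvd_natCast.mp (hpi.dvd_of_dvd_pow h3))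
    · intro h3
      have := Int.natCast_dvd_natCast.mp h3
      exact hlp ((Nat.prime_dvd_prime_iff_eq hp hl).mp this).symm
  have hrp := Nat.eq_prime_pow_of_unique_prime_dvd hr0 huniq
  cases hk : r.primeFactorsList.length with
  | zero =>
    rw [hk] at hrp
    rw [hrp] at hr
    simp at hr
    exact absurd hr.symm hne
  | succ k =>
    rw [hk] at hrp
    exact ⟨k, by rw [← hrp]; exact hr, ho1⟩

lemma nonprim_sq {a b d p : ℕ} (hab : b < a) (hc : a.Coprime b) (hd : 0 < d) (hd2 : d ≠ 2)
    (hp : p.Prime) (h : (p : ℤ) ^ 2 ∣ homCyc a b d) (hne : ordq a b p ≠ d) : False := by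
  have hpi : Prime (p : ℤ) := Nat.prime_iff_prime_int.mp hp
  have h1 : (p : ℤ) ∣ homCyc a b d := (dvd_pow_self _ two_ne_zero).trans h
  obtain ⟨k, hk, ho⟩ := nonprim_struct hab hc hd hp h1 hne
  have h0 := h1.trans (homCyc_dvd hd)
  obtain ⟨hpa, hpb⟩ := coprime_not_dvd hc hd hp h0
  have hpd : p ∣ d := by rw [hk, pow_succ]; exact Dvd.intro_left _ (mul_assoc _ _ _)
  have hdp : d / p = ordq a b p * p ^ k := by
    conv_lhs => rw [hk]
    rw [pow_succ, ← mul_assoc, Nat.mul_div_cancel _ hp.pos]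
  have hg := h.trans (homCyc_dvd_geom hab hd hp.one_lt hpd)
  have hsub : (p : ℤ) ∣ (a : ℤ) ^ (d / p) - (b : ℤ) ^ (d / p) := by
    rw [← ordq_dvd_iff hp hpb, hdp]
    exact dvd_mul_right _ _
  have hpA : ¬ (p : ℤ) ∣ (a : ℤ) ^ (d / p) := fun h3 =>
    hpa (Int.natCast_dvd_natCast.mp (hpi.dvd_of_dvd_pow h3))
  rcases hp.eq_two_or_odd' with rfl | hodd
  · have ho1 : ordq a b 2 = 1 := by simpa using ho
    rw [ho1, one_mul] at hk hdp
    cases k with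
    | zero => simp at hk; omega
    | succ j =>
      rw [hdp] at hg
      simp only [Finset.sum_range_succ, Finset.sum_range_zero] at hg
      rw [pow_succ 2 j, pow_mul, pow_mul] at hg
      have oa : Odd ((a : ℤ) ^ 2 ^ j) := by
        apply Odd.pow
        rw [Int.odd_coe_nat]
        rwa [← Nat.not_even_iff_odd, even_iff_two_dvd]
      have ob : Odd ((b : ℤ) ^ 2 ^ j) := by
        apply Odd.pow
        rw [Int.odd_coe_nat]
        rwa [← Nat.not_even_iff_odd, even_iff_two_dvd]
      have e1 := Int.sq_mod_four_eq_one_of_odd oa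
      have e2 := Int.sq_mod_four_eq_one_of_odd ob
      simp at hg
      omega
  · have he := emultiplicity_geom_sum₂_eq_one hpi hodd hsub hpA
    have := le_emultiplicity_of_pow_dvd hg
    rw [he] at this
    norm_num at this

lemma size_bound {A B p : ℕ} (hB : 0 < B) (hAB : B < A) (hp : 3 ≤ p) :
    (A : ℤ) ^ (p - 2) * (A + B) ≤ (A : ℤ) ^ p - (B : ℤ) ^ p := by
  obtain ⟨j, rfl⟩ := Nat.exists_eq_add_of_le' hp
  have e : j + 3 - 2 = j + 1 := by omega
  rw [e]
  have hB' : (0 : ℤ) < B := by exact_mod_cast hB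
  have hAB' : (B : ℤ) + 1 ≤ A := by exact_mod_cast hAB
  have h1 : (B : ℤ) ^ (j + 1) ≤ (A : ℤ) ^ (j + 1) := by gcongr
  have h2 : (0 : ℤ) < (B : ℤ) ^ (j + 1) := by positivity
  set u := (A : ℤ) ^ (j + 1)
  set v := (B : ℤ) ^ (j + 1)
  have eA : (A : ℤ) ^ (j + 3) = u * A ^ 2 := by rw [show j + 3 = (j + 1) + 2 by ring, pow_add]
  have eB : (B : ℤ) ^ (j + 3) = v * B ^ 2 := by rw [show j + 3 = (j + 1) + 2 by ring, pow_add]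
  rw [eA, eB]
  have h3 : (A : ℤ) + B ≤ A ^ 2 - B ^ 2 := by nlinarith
  have h4 : v * (B : ℤ) ^ 2 ≤ u * B ^ 2 := by nlinarith [sq_nonneg (B : ℤ)]
  nlinarith

lemma small_case {A B : ℕ} (h3 : A ≤ 3) (hBA : B < A) (hB : 0 < B)
    (h : (A : ℤ) ^ 3 - (B : ℤ) ^ 3 ≤ (3 : ℕ) * ((A : ℤ) + B)) : A = 2 ∧ B = 1 := by
  interval_cases A <;> interval_cases B <;> simp at h ⊢

theorem zsig {a b d : ℕ} (hb : 0 < b) (hab : b < a) (hc : a.Coprime b) (hd : 2 ≤ d)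
    (h2 : d = 2 → ∀ k, a + b ≠ 2 ^ k) (h6 : ¬ (d = 6 ∧ a = 2 ∧ b = 1)) :
    ∃ p, p.Prime ∧ ¬ p ∣ b ∧ ordq a b p = d := by
  by_cases hd2 : d = 2
  · subst hd2
    have h3 : ∃ p, p.Prime ∧ p ∣ a + b ∧ p ≠ 2 := by
      by_contra hcon
      push Not at hcon
      exact h2 rfl _ (Nat.eq_prime_pow_of_unique_prime_dvd (by omega)
        (fun {q} hq hqd => hcon q hq hqd))
    obtain ⟨p, hp, hpd, hp2⟩ := h3
    have hdi : (p : ℤ) ∣ (a : ℤ) + b := by exact_mod_cast hpd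
    have hdv : (p : ℤ) ∣ (a : ℤ) ^ 2 - (b : ℤ) ^ 2 := by
      rw [sq_sub_sq]; exact hdi.mul_right _
    obtain ⟨hpa, hpb⟩ := coprime_not_dvd hc two_pos hp hdv
    refine ⟨p, hp, hpb, ?_⟩
    have ho := (ordq_dvd_iff hp hpb 2).mpr hdv
    rcases (Nat.dvd_prime Nat.prime_two).mp ho with h | h
    · exfalso
      have h4 := (ordq_dvd_iff hp hpb 1).mp (by rw [h])
      rw [pow_one, pow_one] at h4
      have h5 : (p : ℤ) ∣ ((2 * a : ℕ) : ℤ) := by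
        have := dvd_add hdi h4
        have e : ((2 * a : ℕ) : ℤ) = ((a : ℤ) + b) + (a - b) := by push_cast; ring
        rw [e]; exact this
      have h6 := Int.natCast_dvd_natCast.mp h5
      rcases (Nat.Prime.dvd_mul hp).mp h6 with h7 | h7
      · exact hp2 ((Nat.prime_dvd_prime_iff_eq hp Nat.prime_two).mp h7)
      · exact hpa h7
    · exact h
  by_contra hcon
  push Not at hcon
  have hd0 : 0 < d := by omega
  have hgt := homCyc_gt_one hb hab hd
  obtain ⟨c, hcc⟩ : ∃ c : ℕ, homCyc a b d = c := ⟨_, (Int.toNat_of_nonneg (by omega)).symm⟩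
  have hc1 : 1 < c := by rw [hcc] at hgt; exact_mod_cast hgt
  have hnp : ∀ p : ℕ, p.Prime → p ∣ c → ordq a b p ≠ d := by
    intro p hp hpc
    have h : (p : ℤ) ∣ homCyc a b d := by rw [hcc]; exact_mod_cast hpc
    exact hcon p hp (coprime_not_dvd hc hd0 hp (h.trans (homCyc_dvd hd0))).2
  have hst : ∀ p : ℕ, p.Prime → p ∣ c →
      ∃ k, d = ordq a b p * p ^ (k + 1) ∧ ordq a b p ∣ p - 1 := by
    intro p hp hpc
    have h : (p : ℤ) ∣ homCyc a b d := by rw [hcc]; exact_mod_cast hpc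
    exact nonprim_struct hab hc hd0 hp h (hnp p hp hpc)
  have hle : ∀ p p' : ℕ, p.Prime → p ∣ c → p'.Prime → p' ∣ c → p' ≤ p := by
    intro p p' hp hpc hp' hpc'
    obtain ⟨k, hk, ho⟩ := hst p hp hpc
    obtain ⟨k', hk', ho'⟩ := hst p' hp' hpc'
    have : p' ∣ d := by rw [hk']; exact (dvd_pow_self _ (by omega)).mul_left _
    rw [hk] at this
    rcases (Nat.Prime.dvd_mul hp').mp this with h | h
    · have := Nat.le_of_dvd (by have := hp.two_le; omega) (h.trans ho)
      omega
    · exact Nat.le_of_dvd hp.pos (hp'.dvd_of_dvd_pow h)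
  obtain ⟨p, hp, hpc⟩ := Nat.exists_prime_and_dvd hc1.ne'
  have hcp : c = p := by
    obtain ⟨c', hc'⟩ := hpc
    by_cases h1 : c' = 1
    · rw [hc', h1, mul_one]
    · exfalso
      obtain ⟨p', hp', hpc'⟩ := Nat.exists_prime_and_dvd h1
      have hpc0 : p ∣ c := hc' ▸ dvd_mul_right _ _
      have hpc1 : p' ∣ c := hc' ▸ hpc'.mul_left _
      have heq : p' = p := le_antisymm (hle p p' hp hpc0 hp' hpc1) (hle p' p hp' hpc1 hp hpc0)
      subst heq
      refine nonprim_sq hab hc hd0 hd2 hp ?_ (hnp _ hp hpc0)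
      rw [hcc, hc']
      push_cast
      rw [sq]
      exact mul_dvd_mul_left _ (by exact_mod_cast hpc')
  subst hcp
  obtain ⟨k, hk, ho⟩ := hst c hp hpc
  set o := ordq a b c with hodef
  have hpdv : (c : ℤ) ∣ (a : ℤ) ^ d - (b : ℤ) ^ d := by
    have := homCyc_dvd (a := a) (b := b) hd0
    rwa [hcc] at this
  obtain ⟨hpa, hpb⟩ := coprime_not_dvd hc hd0 hp hpdv
  have h2c := hp.two_le
  have hopos : 0 < o := Nat.pos_of_dvd_of_pos ho (by omega)
  have hole : o ≤ c - 1 := Nat.le_of_dvd (by omega) ho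
  have hco : ¬ c ∣ o := fun h => by
    have := Nat.le_of_dvd hopos h
    omega
  by_cases hc2 : c = 2
  · have ho1 : o = 1 := by omega
    have := homCyc_two_pow (k := k) hb hab
    rw [ho1, one_mul, hc2] at hk
    rw [← hk, hcc, hc2] at this
    norm_num at this
  have hc3 : 3 ≤ c := by omega
  have hbd := homCyc_bound (o := o) (k := k) hb hab hp hco
  rw [← hk, hcc, pow_mul, pow_mul] at hbd
  have hck : c ^ k ≠ 0 := pow_ne_zero _ hp.ne_zero
  obtain ⟨A, hA⟩ : ∃ A, A = a ^ c ^ k := ⟨_, rfl⟩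
  obtain ⟨B, hB⟩ : ∃ B, B = b ^ c ^ k := ⟨_, rfl⟩
  have hBpos : 0 < B := hB ▸ pow_pos hb _
  have hBA : B < A := by rw [hA, hB]; exact Nat.pow_lt_pow_left hab hck
  have hA' : (a : ℤ) ^ c ^ k = A := by rw [hA]; push_cast; rfl
  have hB' : (b : ℤ) ^ c ^ k = B := by rw [hB]; push_cast; rfl
  rw [hA', hB'] at hbd
  have hsz := size_bound hBpos hBA hc3
  have hf : 0 < o.totient := Nat.totient_pos.mpr hopos
  have hABpos : (0 : ℤ) < (A : ℤ) + B := by positivity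
  have hApow : (A : ℤ) ^ (c - 2) ≤ c := by
    have h7 : ((A : ℤ) ^ (c - 2)) ^ o.totient * ((A : ℤ) + B) ^ o.totient ≤
        c * ((A : ℤ) + B) ^ o.totient := by
      rw [← mul_pow]
      refine le_trans ?_ hbd
      gcongr
    have h8 := le_of_mul_le_mul_right h7 (by positivity)
    refine le_trans (le_self_pow₀ ?_ hf.ne') h8
    apply one_le_pow₀
    have : 1 ≤ A := by omega
    exact_mod_cast this
  have hApow' : A ^ (c - 2) ≤ c := by exact_mod_cast hApow
  by_cases hc3' : c = 3
  · have ho12 : o = 1 ∨ o = 2 := by omega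
    have hft : o.totient = 1 := by rcases ho12 with h | h <;> rw [h] <;> rfl
    rw [hft, pow_one, pow_one, hc3'] at hbd
    rw [hc3'] at hApow'
    norm_num at hApow'
    have hAB : A = 2 ∧ B = 1 := small_case hApow' hBA hBpos hbd
    have hb1 : b = 1 := by
      have : b ≤ b ^ c ^ k := Nat.le_self_pow hck b
      omega
    have ha2 : a = 2 := by
      have : a ≤ a ^ c ^ k := Nat.le_self_pow hck a
      omega
    have hk0 : k = 0 := by
      rw [hAB.1, ha2] at hA
      have h9 : c ^ k = 1 := by
        have := Nat.pow_right_injective (le_refl 2) (show 2 ^ 1 = 2 ^ c ^ k by simpa using hA)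
        exact this.symm
      rcases Nat.pow_eq_one.mp h9 with h | h
      · omega
      · exact h
    rw [hk0, hc3'] at hk
    rcases ho12 with h | h
    · have h4 := (ordq_dvd_iff hp hpb 1).mp (by rw [← hodef, h])
      rw [hc3', ha2, hb1] at h4
      norm_num at h4
    · rw [h] at hk
      exact h6 ⟨by simpa using hk, ha2, hb1⟩
  · have hc4 : c ≠ 4 := by rintro rfl; revert hp; norm_num
    have h2A : 2 ^ (c - 2) ≤ A ^ (c - 2) := Nat.pow_le_pow_left (by omega) _
    obtain ⟨j, rfl⟩ := Nat.exists_eq_add_of_le' (show 5 ≤ c by omega)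
    have e : j + 5 - 2 = j + 3 := by omega
    rw [e] at h2A hApow'
    have : j < 2 ^ j := Nat.lt_two_pow_self
    have e2 : 2 ^ (j + 3) = 8 * 2 ^ j := by ring
    omega

/-- The natural number `(a ^ k - b ^ k) / (a - b)`. -/
def gq (a b k : ℕ) : ℕ := ∑ i ∈ Finset.range k, a ^ i * b ^ (k - 1 - i)

lemma gq_cast (a b k : ℕ) :
    (gq a b k : ℤ) = ∑ i ∈ Finset.range k, (a : ℤ) ^ i * (b : ℤ) ^ (k - 1 - i) := by
  simp [gq]

lemma gq_mul (a b k : ℕ) : (gq a b k : ℤ) * ((a : ℤ) - b) = (a : ℤ) ^ k - (b : ℤ) ^ k := by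
  rw [gq_cast, geom_sum₂_mul]

lemma gq_pos {a b k : ℕ} (hb : 0 < b) (hab : b < a) (hk : 0 < k) : 0 < gq a b k := by
  apply Finset.sum_pos
  · intro i _
    have : 0 < a := by omega
    positivity
  · exact ⟨0, by simpa using hk⟩

lemma gq_dvd {a b e m : ℕ} (hab : b < a) (h : e ∣ m) : gq a b e ∣ gq a b m := by
  have hne : ((a : ℤ) - b) ≠ 0 := by
    have : (b : ℤ) < a := by exact_mod_cast hab
    linarith
  rw [← Int.natCast_dvd_natCast, ← mul_dvd_mul_iff_right hne, gq_mul, gq_mul]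
  obtain ⟨r, rfl⟩ := h
  rw [pow_mul, pow_mul]
  exact sub_dvd_pow_sub_pow _ _ _

lemma quot_eq {a b c k : ℕ} (hab : b < a) (hc : 0 < c) (hk : 0 < k) :
    ((c * a) ^ k - (c * b) ^ k) / (c * a - c * b) = c ^ (k - 1) * gq a b k := by
  have h1 : c * b < c * a := Nat.mul_lt_mul_of_pos_left hab hc
  have h2 : (c * b) ^ k ≤ (c * a) ^ k := Nat.pow_le_pow_left h1.le _
  apply Nat.div_eq_of_eq_mul_left (by omega)
  zify [h2, h1.le]
  have e : (c : ℤ) ^ k = c ^ (k - 1) * c := by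
    rw [← pow_succ, Nat.sub_add_cancel hk]
  rw [mul_pow, mul_pow, ← mul_sub, ← gq_mul, e]
  ring

lemma not_dvd_gq {a b n q : ℕ} (hq : q.Prime) (hqn : ¬ q ∣ n) (hqa : ¬ q ∣ a)
    (h : (q : ℤ) ∣ (a : ℤ) - b) : ¬ q ∣ gq a b n := by
  rw [← Int.natCast_dvd_natCast, gq_cast]
  apply not_dvd_geom_sum₂ (Nat.prime_iff_prime_int.mp hq) h
  · rwa [Int.natCast_dvd_natCast]
  · rwa [Int.natCast_dvd_natCast]

lemma lift_dvd {a b n q j : ℕ} (hab : b < a) (hc : a.Coprime b) (hn : 0 < n)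
    (hq : q.Prime) (hqn : ¬ q ∣ n) (h : q ^ j ∣ gq a b n) :
    q ^ j ∣ a ^ (q - 1) - b ^ (q - 1) := by
  rcases Nat.eq_zero_or_pos j with rfl | hj
  · simp
  have hqi : Prime (q : ℤ) := Nat.prime_iff_prime_int.mp hq
  have h1 : (q : ℤ) ^ j ∣ (a : ℤ) ^ n - (b : ℤ) ^ n := by
    rw [← gq_mul]
    exact Dvd.dvd.mul_right (by exact_mod_cast h) _
  have h2 : (q : ℤ) ∣ (a : ℤ) ^ n - (b : ℤ) ^ n := (dvd_pow_self _ hj.ne').trans h1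
  obtain ⟨hqa, hqb⟩ := coprime_not_dvd hc hn hq h2
  have h3 : (q : ℤ) ∣ (a : ℤ) ^ (q - 1) - (b : ℤ) ^ (q - 1) := by
    rw [← ordq_dvd_iff hq hqb]
    exact ordq_dvd_sub_one hq hqb hqa
  have h4 : (q : ℤ) ^ j ∣ ((a : ℤ) ^ (q - 1)) ^ n - ((b : ℤ) ^ (q - 1)) ^ n := by
    rw [pow_right_comm, pow_right_comm (b : ℤ)]
    exact h1.trans (sub_dvd_pow_sub_pow _ _ _)
  have hnd := not_dvd_geom_sum₂ (n := n) hqi h3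
    (fun h5 => hqa (Int.natCast_dvd_natCast.mp (hqi.dvd_of_dvd_pow h5)))
    (by rwa [Int.natCast_dvd_natCast])
  rw [← geom_sum₂_mul] at h4
  have h6 := IsCoprime.dvd_of_dvd_mul_left
    (IsCoprime.pow_left ((Prime.coprime_iff_not_dvd hqi).mpr hnd)) h4
  have hle : b ^ (q - 1) ≤ a ^ (q - 1) := Nat.pow_le_pow_left hab.le _
  zify [hle]
  exact h6

lemma two_mul_sum_val (m q : ℕ) (hm : 0 < m) :
    m.factorization q * m.divisors.card = 2 * ∑ d ∈ m.divisors, d.factorization q := by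
  rw [two_mul]
  nth_rewrite 1 [← Nat.sum_div_divisors]
  rw [← Finset.sum_add_distrib, mul_comm, ← smul_eq_mul, ← Finset.sum_const]
  apply Finset.sum_congr rfl
  intro d hd
  have hdm := Nat.dvd_of_mem_divisors hd
  have hd0 : d ≠ 0 := (Nat.pos_of_mem_divisors hd).ne'
  have h0 : m / d ≠ 0 := (Nat.div_pos (Nat.le_of_dvd hm hdm) (Nat.pos_of_ne_zero hd0)).ne'
  conv_lhs => rw [← Nat.div_mul_cancel hdm]
  rw [Nat.factorization_mul h0 hd0]
  rfl

lemma val_totient (N q : ℕ) (hN : N ≠ 0) (hq : q.Prime) :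
    (Nat.totient N).factorization q + (if q ∣ N then 1 else 0)
      = N.factorization q + ∑ p ∈ N.primeFactors, (p - 1).factorization q := by
  have h := congrArg (fun t => t.factorization q) (Nat.totient_mul_prod_primeFactors N)
  have h1 : (∏ p ∈ N.primeFactors, p) ≠ 0 :=
    Finset.prod_ne_zero_iff.mpr fun p hp => (Nat.prime_of_mem_primeFactors hp).ne_zero
  have h2' : ∀ p ∈ N.primeFactors, p - 1 ≠ 0 := fun p hp => by
    have := (Nat.prime_of_mem_primeFactors hp).two_le
    omega
  have h2 : (∏ p ∈ N.primeFactors, (p - 1)) ≠ 0 := Finset.prod_ne_zero_iff.mpr h2'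
  have h3 : N.totient ≠ 0 := (Nat.totient_pos.mpr (Nat.pos_of_ne_zero hN)).ne'
  rw [Nat.factorization_mul h3 h1, Nat.factorization_mul hN h2,
    Nat.factorization_prod h2', Nat.factorization_prod
      (fun p hp => (Nat.prime_of_mem_primeFactors hp).ne_zero)] at h
  simp only [Finsupp.add_apply, Finsupp.finset_sum_apply] at h
  rw [← h]
  congr 1
  have h4 : ∀ p ∈ N.primeFactors, p.factorization q = if q = p then 1 else 0 := by
    intro p hp
    rw [(Nat.prime_of_mem_primeFactors hp).factorization, Finsupp.single_apply]
    simp [eq_comm]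
  rw [Finset.sum_congr rfl h4, Finset.sum_ite_eq]
  simp [hq, hN]

lemma val_ge {a b m N q : ℕ} (hm : 0 < m) (hab : b < a) (hq : q.Prime) (hN : N ≠ 0)
    (hQN : gq a b m ∣ N)
    (hz : ∀ d, d ∣ m → q ∣ d → ∃ p, p.Prime ∧ ¬ p ∣ b ∧ ordq a b p = d) (hc : a.Coprime b) :
    ∑ d ∈ m.divisors, d.factorization q ≤ ∑ p ∈ N.primeFactors, (p - 1).factorization q := by
  classical
  choose! P hP using hz
  have e : ∑ d ∈ m.divisors, d.factorization q
      = ∑ d ∈ m.divisors.filter (q ∣ ·), d.factorization q := by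
    symm
    apply Finset.sum_filter_of_ne
    intro d _ hd
    by_contra hqd
    exact hd (Nat.factorization_eq_zero_of_not_dvd hqd)
  rw [e]
  have hP' : ∀ d ∈ m.divisors.filter (q ∣ ·), (P d).Prime ∧ ¬ P d ∣ b ∧ ordq a b (P d) = d := by
    intro d hd
    rw [Finset.mem_filter] at hd
    exact hP d (Nat.dvd_of_mem_divisors hd.1) hd.2
  have hinj : Set.InjOn P (m.divisors.filter (q ∣ ·)) := by
    intro d hd d' hd' h
    rw [← (hP' d hd).2.2, ← (hP' d' hd').2.2, h]
  have hdv : ∀ d ∈ m.divisors.filter (q ∣ ·),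
      (P d : ℤ) ∣ (a : ℤ) ^ m - (b : ℤ) ^ m := by
    intro d hd
    obtain ⟨h1, h2, h3⟩ := hP' d hd
    rw [← ordq_dvd_iff h1 h2, h3]
    exact Nat.dvd_of_mem_divisors (Finset.mem_filter.mp hd).1
  calc ∑ d ∈ m.divisors.filter (q ∣ ·), d.factorization q
      ≤ ∑ d ∈ m.divisors.filter (q ∣ ·), (P d - 1).factorization q := by
        apply Finset.sum_le_sum
        intro d hd
        obtain ⟨h1, h2, h3⟩ := hP' d hd
        have hdvd := ordq_dvd_sub_one h1 h2 (coprime_not_dvd hc hm h1 (hdv d hd)).1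
        rw [h3] at hdvd
        have hne : P d - 1 ≠ 0 := by have := h1.two_le; omega
        exact (Nat.factorization_le_iff_dvd (ne_zero_of_dvd_ne_zero hne hdvd) hne).mpr hdvd q
    _ = ∑ p ∈ (m.divisors.filter (q ∣ ·)).image P, (p - 1).factorization q := by
        rw [Finset.sum_image hinj]
    _ ≤ _ := by
        apply Finset.sum_le_sum_of_subset
        intro p hp
        obtain ⟨d, hd, rfl⟩ := Finset.mem_image.mp hp
        obtain ⟨h1, h2, h3⟩ := hP' d hd
        rw [Nat.mem_primeFactors]
        refine ⟨h1, ?_, hN⟩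
        refine dvd_trans ?_ hQN
        have h4 := hdv d hd
        rw [← gq_mul] at h4
        rcases (Nat.prime_iff_prime_int.mp h1).dvd_or_dvd h4 with h5 | h5
        · exact Int.natCast_dvd_natCast.mp h5
        · exfalso
          have h6 := (ordq_dvd_iff h1 h2 1).mpr (by simpa using h5)
          rw [h3] at h6
          have h7 := (Finset.mem_filter.mp hd).2.trans h6
          exact hq.one_lt.ne' (Nat.dvd_one.mp h7)

lemma main_aux {a b c z m n q : ℕ} (hb : 0 < b) (hab : b < a) (hc : a.Coprime b) (hc0 : 0 < c)
    (hz : 0 < z) (hn : 0 < n) (hgcd : Nat.gcd m n = 1) (hmn : n < m)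
    (heq : Nat.totient (z * (c ^ (m - 1) * gq a b m)) = z * (c ^ (n - 1) * gq a b n))
    (hq : q.Prime) (hqm : q ∣ m) :
    (∑ d ∈ m.divisors, d.factorization q) - 1 ≤ (gq a b n).factorization q ∧
    (¬ q ∣ z → ∑ d ∈ m.divisors, d.factorization q ≤ (gq a b n).factorization q) := by
  have hm : 0 < m := by omega
  have hqn : ∀ r : ℕ, r.Prime → r ∣ m → ¬ r ∣ n := fun r hr h1 h2 => hr.one_lt.ne'
    (Nat.dvd_one.mp (by have := Nat.dvd_gcd h1 h2; rwa [hgcd] at this))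
  have hQm := (gq_pos hb hab hm).ne'
  have hQn := (gq_pos hb hab hn).ne'
  have hcm : c ^ (m - 1) ≠ 0 := pow_ne_zero _ hc0.ne'
  have hcn : c ^ (n - 1) ≠ 0 := pow_ne_zero _ hc0.ne'
  have hN : z * (c ^ (m - 1) * gq a b m) ≠ 0 := mul_ne_zero hz.ne' (mul_ne_zero hcm hQm)
  have hQN : gq a b m ∣ z * (c ^ (m - 1) * gq a b m) :=
    (Dvd.intro_left _ rfl : gq a b m ∣ c ^ (m - 1) * gq a b m).mul_left _
  have hv := val_totient _ q hN hq
  rw [heq, Nat.factorization_mul hz.ne' (mul_ne_zero hcn hQn), Nat.factorization_mul hcn hQn,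
    Nat.factorization_mul hz.ne' (mul_ne_zero hcm hQm), Nat.factorization_mul hcm hQm,
    Nat.factorization_pow, Nat.factorization_pow] at hv
  simp only [Finsupp.add_apply, Finsupp.smul_apply, smul_eq_mul] at hv
  have hcle : (n - 1) * c.factorization q + c.factorization q ≤ (m - 1) * c.factorization q := by
    have : n - 1 + 1 ≤ m - 1 := by omega
    have := Nat.mul_le_mul_right (c.factorization q) this
    rwa [add_mul, one_mul] at this
  -- the exceptional cases lead to a contradiction
  have hbad : ¬ q ∣ gq a b n → 2 ≤ (gq a b m).factorization q +
      ∑ p ∈ (z * (c ^ (m - 1) * gq a b m)).primeFactors, (p - 1).factorization q → False := by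
    intro h1 h2
    have h3 := Nat.factorization_eq_zero_of_not_dvd h1
    split_ifs at hv <;> omega
  have hzs : ∀ d, d ∣ m → q ∣ d → ∃ p, p.Prime ∧ ¬ p ∣ b ∧ ordq a b p = d := by
    intro d hdm hqd
    have hd0 : 0 < d := Nat.pos_of_dvd_of_pos hdm hm
    have hd2 : 2 ≤ d := hq.two_le.trans (Nat.le_of_dvd hd0 hqd)
    apply zsig hb hab hc hd2
    · rintro rfl k hk
      have hq2 : q = 2 := (Nat.prime_dvd_prime_iff_eq hq Nat.prime_two).mp hqd
      subst hq2
      have hk2 : 2 ≤ k := by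
        by_contra hlt
        have : k = 0 ∨ k = 1 := by omega
        rcases this with rfl | rfl <;> simp at hk <;> omega
      have h4 : 4 ∣ a + b := by
        rw [hk]; exact pow_dvd_pow 2 hk2
      have ha2 : ¬ 2 ∣ a := by
        intro h
        have h5 : 2 ∣ b := by omega
        have := Nat.dvd_gcd h h5
        rw [hc] at this
        omega
      refine hbad (not_dvd_gq hq (hqn 2 hq hqm) ha2 ?_) ?_
      · push_cast; omega
      · have h5 : 2 ^ 2 ∣ gq a b m := by
          refine dvd_trans ?_ (gq_dvd hab hdm)
          simpa [gq, Finset.sum_range_succ, add_comm] using h4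
        have := (hq.pow_dvd_iff_le_factorization hQm).mp h5
        omega
    · rintro ⟨rfl, rfl, rfl⟩
      have h63 : 63 ∣ gq 2 1 m := by
        have := gq_dvd (a := 2) (b := 1) (by norm_num) hdm
        simpa [gq, Finset.sum_range_succ] using this
      have hq23 : q = 2 ∨ q = 3 := by
        have h6 : q ∣ 2 * 3 := by simpa using hqd
        rcases (Nat.Prime.dvd_mul hq).mp h6 with h | h
        · exact Or.inl ((Nat.prime_dvd_prime_iff_eq hq Nat.prime_two).mp h)
        · exact Or.inr ((Nat.prime_dvd_prime_iff_eq hq Nat.prime_three).mp h)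
      have hqgn : ∀ k : ℕ, gq 2 1 k + 1 = 2 ^ k := by
        intro k
        have := gq_mul 2 1 k
        push_cast at this
        norm_num at this
        zify
        linarith
      have hodd : Odd n := by
        rw [← Nat.not_even_iff_odd, even_iff_two_dvd]
        exact hqn 2 Nat.prime_two ((by norm_num : 2 ∣ 6).trans hdm)
      obtain ⟨j, rfl⟩ := hodd
      have hj := hqgn (2 * j + 1)
      rw [pow_succ, pow_mul] at hj
      rcases hq23 with rfl | rfl
      · refine hbad (by omega) ?_
        set N := z * (c ^ (m - 1) * gq 2 1 m)
        have h3 : 3 ∈ N.primeFactors := Nat.mem_primeFactors.mpr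
          ⟨by norm_num, ((by norm_num : 3 ∣ 63).trans h63).trans hQN, hN⟩
        have h7 : 7 ∈ N.primeFactors := Nat.mem_primeFactors.mpr
          ⟨by norm_num, ((by norm_num : 7 ∣ 63).trans h63).trans hQN, hN⟩
        have hsub : ({3, 7} : Finset ℕ) ⊆ N.primeFactors := by
          intro t ht
          simp only [Finset.mem_insert, Finset.mem_singleton] at ht
          rcases ht with rfl | rfl <;> assumption
        have hle := Finset.sum_le_sum_of_subset (f := fun p => (p - 1).factorization 2) hsub
        rw [Finset.sum_pair (by norm_num)] at hle
        have e1 : 1 ≤ (3 - 1 : ℕ).factorization 2 :=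
          (hq.dvd_iff_one_le_factorization (by norm_num)).mp (by norm_num)
        have e2 : 1 ≤ (7 - 1 : ℕ).factorization 2 :=
          (hq.dvd_iff_one_le_factorization (by norm_num)).mp (by norm_num)
        omega
      · refine hbad ?_ ?_
        · have h4 : 4 ^ j % 3 = 1 := by
            rw [Nat.pow_mod]; simp
          norm_num at hj
          omega
        · have h5 : 3 ^ 2 ∣ gq 2 1 m := (by norm_num : 3 ^ 2 ∣ 63).trans h63
          have := (hq.pow_dvd_iff_le_factorization hQm).mp h5
          omega
  have hge := val_ge hm hab hq hN hQN hzs hc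
  constructor
  · split_ifs at hv <;> omega
  · intro hqz
    split_ifs at hv with hdiv
    · rcases (Nat.Prime.dvd_mul hq).mp hdiv with h | h
      · exact absurd h hqz
      rcases (Nat.Prime.dvd_mul hq).mp h with h | h
      · have := (hq.dvd_iff_one_le_factorization hc0.ne').mp (hq.dvd_of_dvd_pow h)
        omega
      · have := (hq.dvd_iff_one_le_factorization hQm).mp h
        omega
    · omega


theorem pow_prime_dvd_of_prime_dvd (x y z m n : ℕ) (hx : 0 < x) (hy : 0 < y) (hz : 0 < z)
    (hm : 0 < m) (hn : 0 < n) (hxy : y < x) (hzxy : z ≤ x - y)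
    (hgcd : Nat.gcd m n = 1) (hmn : n < m)
    (heq : Nat.totient (z * ((x ^ m - y ^ m) / (x - y))) =
      z * ((x ^ n - y ^ n) / (x - y)))
    (d₁ x₁ y₁ : ℕ) (hd₁ : d₁ = Nat.gcd x y) (hx₁ : x₁ = x / d₁) (hy₁ : y₁ = y / d₁)
    (q : ℕ) (hq : q.Prime) (hqm : q ∣ m) :
    Even (m.factorization q * m.divisors.card) ∧
    q ^ (m.factorization q * m.divisors.card / 2 - 1) ∣ x₁ ^ (q - 1) - y₁ ^ (q - 1) ∧
    (¬ q ∣ z → q ^ (m.factorization q * m.divisors.card / 2) ∣ x₁ ^ (q - 1) - y₁ ^ (q - 1)) := by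
  have hcpos : 0 < d₁ := hd₁ ▸ Nat.gcd_pos_of_pos_left _ hx
  have ex : x = d₁ * x₁ := by
    rw [hx₁, Nat.mul_div_cancel' (hd₁ ▸ Nat.gcd_dvd_left x y)]
  have ey : y = d₁ * y₁ := by
    rw [hy₁, Nat.mul_div_cancel' (hd₁ ▸ Nat.gcd_dvd_right x y)]
  have hcop : x₁.Coprime y₁ := by
    rw [hx₁, hy₁, hd₁]
    exact Nat.coprime_div_gcd_div_gcd (hd₁ ▸ hcpos)
  have hb : 0 < y₁ := Nat.pos_of_ne_zero (by rintro h; rw [h] at ey; omega)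
  have hab : y₁ < x₁ := by
    rw [ex, ey] at hxy
    exact Nat.lt_of_mul_lt_mul_left hxy
  rw [ex, ey, quot_eq hab hcpos hm, quot_eq hab hcpos hn] at heq
  have hqn : ¬ q ∣ n := fun h2 => hq.one_lt.ne'
    (Nat.dvd_one.mp (by have := Nat.dvd_gcd hqm h2; rwa [hgcd] at this))
  obtain ⟨h1, h2⟩ := main_aux hb hab hcop hcpos hz hn hgcd hmn heq hq hqm
  have hQn := (gq_pos hb hab hn).ne'
  rw [two_mul_sum_val m q hm, Nat.mul_div_cancel_left _ two_pos]
  refine ⟨even_two_mul _, ?_, fun hqz => ?_⟩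
  · exact lift_dvd hab hcop hn hq hqn ((hq.pow_dvd_iff_le_factorization hQn).mpr h1)
  · exact lift_dvd hab hcop hn hq hqn ((hq.pow_dvd_iff_le_factorization hQn).mpr (h2 hqz))
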